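/- arXiv:dg-ga/9512010 — 3 statements merged into one kernel-verified Lean document; each statement's English description precedes it below -/
import Mathlib

section
/- Let U ⊆ ℝ × ℂ^{m−1} ≅ ℝ^{2m−1} be open and let z : U → ℂ be a C² function such that for every point (x², q², …, q^m) ∈ U, Φ̃(x², q, z(x²,q)) = 0 and the complex derivative ∂Φ̃/∂ζ at (x², q, z(x²,q)) is nonzero. Then z is a harmonic morphism on U: (∂z/∂x²)² + Σ_{j=3}^{2m} (∂z/∂x^j)² = 0 and ∂²z/(∂x²)² + Σ_{j=3}^{2m} ∂²z/(∂x^j)² = 0 at every point of U. -/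
open Matrix

/-- The complex derivative `∂/∂q_i = (∂/∂x - I ∂/∂y) / 2` of a real-linear form. -/
noncomputable def wirtinger {n : ℕ} (A : ℝ × (Fin n → ℂ) → ℂ) (i : Fin n) : ℂ :=
  (A (0, Pi.single i 1) - Complex.I * A (0, Pi.single i Complex.I)) / 2

theorem sum_symm_mul_antisymm_eq_zero {ι : Type*} [Fintype ι] (S N : ι → ι → ℂ)
    (hS : ∀ i j, S i j = S j i) (hN : ∀ i j, N i j = -N j i) :
    ∑ i, ∑ j, S i j * N i j = 0 := by
  have h : ∑ i, ∑ j, S i j * N i j = -∑ i, ∑ j, S i j * N i j := by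
    conv_lhs => rw [Finset.sum_comm]
    rw [← Finset.sum_neg_distrib]
    refine Finset.sum_congr rfl fun i _ => ?_
    rw [← Finset.sum_neg_distrib]
    refine Finset.sum_congr rfl fun j _ => ?_
    rw [hS j i, hN j i]; ring
  exact self_eq_neg.mp h

/-- The algebraic identity `⟨c·L, c·L⟩ = 0` behind horizontal weak conformality. -/
theorem sum_sq_eq_zero_of_weierstrass {n : ℕ} (D : ℝ × (Fin n → ℂ) → ℂ) (mu : Fin n → ℂ)
    (N : Fin n → Fin n → ℂ) (hN : ∀ i j, N i j = -N j i)
    (hx : D (1, 0) = -2 * Complex.I * ∑ i, mu i * wirtinger D i)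
    (hq : ∀ j, (D (0, Pi.single j 1) + Complex.I * D (0, Pi.single j Complex.I)) / 2
      = -∑ i, wirtinger D i * (N i j - mu i * mu j)) :
    D (1, 0) ^ 2 + ∑ j, (D (0, Pi.single j 1) ^ 2 + D (0, Pi.single j Complex.I) ^ 2) = 0 := by
  have key : ∀ j, D (0, Pi.single j 1) ^ 2 + D (0, Pi.single j Complex.I) ^ 2
      = -4 * ∑ i, (wirtinger D j * wirtinger D i) * N i j
        + 4 * (mu j * wirtinger D j) * ∑ i, mu i * wirtinger D i := by
    intro j
    have h1 : D (0, Pi.single j 1) ^ 2 + D (0, Pi.single j Complex.I) ^ 2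
        = 4 * wirtinger D j
          * ((D (0, Pi.single j 1) + Complex.I * D (0, Pi.single j Complex.I)) / 2) := by
      unfold wirtinger
      linear_combination (D (0, Pi.single j Complex.I) ^ 2) * Complex.I_sq
    rw [h1, hq j, mul_neg, Finset.mul_sum, Finset.mul_sum, Finset.mul_sum,
      ← Finset.sum_neg_distrib, ← Finset.sum_add_distrib]
    exact Finset.sum_congr rfl fun i _ => by ring
  have h0 := sum_symm_mul_antisymm_eq_zero
    (fun i j => wirtinger D i * wirtinger D j) (fun i j => N j i)
    (fun i j => mul_comm _ _) (fun i j => hN j i)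
  simp only [key]
  rw [Finset.sum_add_distrib, ← Finset.mul_sum, h0, ← Finset.sum_mul, ← Finset.mul_sum, hx]
  linear_combination 4 * (∑ i, mu i * wirtinger D i) ^ 2 * Complex.I_sq

/-- The algebraic identity behind harmonicity: `B` plays the role of the second derivative. -/
theorem trace_eq_zero_of_weierstrass {n : ℕ}
    (B : ℝ × (Fin n → ℂ) → ℝ × (Fin n → ℂ) → ℂ) (D : ℝ × (Fin n → ℂ) → ℂ)
    (mu mu' : Fin n → ℂ) (N N' : Fin n → Fin n → ℂ)
    (hB : ∀ v w, B v w = B w v)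
    (hN : ∀ i j, N i j = -N j i) (hN' : ∀ i j, N' i j = -N' j i)
    (hx : D (1, 0) = -2 * Complex.I * ∑ i, mu i * wirtinger D i)
    (hBx : ∀ h, B h (1, 0)
      = -2 * Complex.I * ∑ i, (mu' i * D h * wirtinger D i + mu i * wirtinger (B h) i))
    (hBq : ∀ j h, (B h (0, Pi.single j 1) + Complex.I * B h (0, Pi.single j Complex.I)) / 2
      = -∑ i, (wirtinger (B h) i * (N i j - mu i * mu j)
          + wirtinger D i * ((N' i j - mu' i * mu j - mu i * mu' j) * D h))) :
    B (1, 0) (1, 0) + ∑ j, (B (0, Pi.single j 1) (0, Pi.single j 1)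
      + B (0, Pi.single j Complex.I) (0, Pi.single j Complex.I)) = 0 := by
  set c := wirtinger D with hc
  set Z : Fin n → Fin n → ℂ := fun k i => wirtinger (fun h => wirtinger (B h) i) k with hZ
  have hZsymm : ∀ i j, Z i j = Z j i := by
    intro i j
    simp only [hZ, wirtinger]
    rw [hB (0, Pi.single i 1) (0, Pi.single j 1),
      hB (0, Pi.single i Complex.I) (0, Pi.single j 1),
      hB (0, Pi.single i 1) (0, Pi.single j Complex.I),
      hB (0, Pi.single i Complex.I) (0, Pi.single j Complex.I)]
    ring
  have hZx : ∀ k, wirtinger (B (1, 0)) k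
      = -2 * Complex.I * ∑ i, (mu' i * c k * c i + mu i * Z k i) := by
    intro k
    have h1 : wirtinger (B (1, 0)) k
        = (B (0, Pi.single k 1) (1, 0) - Complex.I * B (0, Pi.single k Complex.I) (1, 0)) / 2 := by
      simp only [wirtinger]
      rw [hB (1, 0), hB (1, 0)]
    rw [h1, hBx, hBx]
    have h2 : ∑ i, (mu' i * c k * c i + mu i * Z k i)
        = (∑ i, (mu' i * D (0, Pi.single k 1) * c i
              + mu i * wirtinger (B (0, Pi.single k 1)) i)
          - Complex.I * ∑ i, (mu' i * D (0, Pi.single k Complex.I) * c i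
              + mu i * wirtinger (B (0, Pi.single k Complex.I)) i)) / 2 := by
      rw [Finset.mul_sum, ← Finset.sum_sub_distrib, Finset.sum_div]
      refine Finset.sum_congr rfl fun i _ => ?_
      have hck : c k = (D (0, Pi.single k 1) - Complex.I * D (0, Pi.single k Complex.I)) / 2 := rfl
      have hZk : Z k i = (wirtinger (B (0, Pi.single k 1)) i
        - Complex.I * wirtinger (B (0, Pi.single k Complex.I)) i) / 2 := rfl
      rw [hck, hZk]; ring
    rw [h2]; ring
  have hxx : B (1, 0) (1, 0)
      = -8 * (∑ i, mu i * c i) * (∑ i, mu' i * c i) - 4 * ∑ k, ∑ i, mu k * mu i * Z k i := by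
    have h1 : ∀ k, ∑ i, (mu' i * c k * c i + mu i * Z k i)
        = c k * ∑ i, mu' i * c i + ∑ i, mu i * Z k i := fun k => by
      rw [Finset.mul_sum, ← Finset.sum_add_distrib]
      exact Finset.sum_congr rfl fun i _ => by ring
    have h2 : ∑ i, (mu' i * D (1, 0) * c i + mu i * wirtinger (B (1, 0)) i)
        = D (1, 0) * (∑ i, mu' i * c i) + -2 * Complex.I * ((∑ k, mu k * c k) * (∑ i, mu' i * c i)
          + ∑ k, ∑ i, mu k * mu i * Z k i) := by
      rw [Finset.sum_mul, ← Finset.sum_add_distrib, Finset.mul_sum (a := -2 * Complex.I),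
        Finset.mul_sum (a := D (1, 0)), Finset.sum_add_distrib]
      congr 1
      · exact Finset.sum_congr rfl fun i _ => by ring
      · refine Finset.sum_congr rfl fun k _ => ?_
        rw [hZx, h1]
        simp only [mul_assoc, ← Finset.mul_sum]
        ring
    rw [hBx, h2, hx]
    linear_combination (8 * (∑ i, mu i * c i) * (∑ i, mu' i * c i)
      + 4 * ∑ k, ∑ i, mu k * mu i * Z k i) * Complex.I_sq
  have hqq : ∀ j, B (0, Pi.single j 1) (0, Pi.single j 1)
      + B (0, Pi.single j Complex.I) (0, Pi.single j Complex.I)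
      = -4 * ∑ i, Z j i * N i j - 4 * ∑ i, (c j * c i) * N' i j
        + 4 * ∑ i, mu j * mu i * Z j i
        + 4 * (mu j * c j) * (∑ i, mu' i * c i) + 4 * (mu' j * c j) * ∑ i, mu i * c i := by
    intro j
    have h1 : B (0, Pi.single j 1) (0, Pi.single j 1)
        + B (0, Pi.single j Complex.I) (0, Pi.single j Complex.I)
        = 2 * (((B (0, Pi.single j 1) (0, Pi.single j 1)
            + Complex.I * B (0, Pi.single j 1) (0, Pi.single j Complex.I)) / 2)
          - Complex.I * ((B (0, Pi.single j Complex.I) (0, Pi.single j 1)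
            + Complex.I * B (0, Pi.single j Complex.I) (0, Pi.single j Complex.I)) / 2)) := by
      rw [hB (0, Pi.single j Complex.I) (0, Pi.single j 1)]
      linear_combination
        B (0, Pi.single j Complex.I) (0, Pi.single j Complex.I) * Complex.I_sq
    rw [h1, hBq, hBq]
    simp only [Finset.mul_sum, mul_neg, ← Finset.sum_neg_distrib, ← Finset.sum_add_distrib,
      ← Finset.sum_sub_distrib]
    refine Finset.sum_congr rfl fun i _ => ?_
    have hcj : c j = (D (0, Pi.single j 1) - Complex.I * D (0, Pi.single j Complex.I)) / 2 := rfl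
    have hZj : Z j i = (wirtinger (B (0, Pi.single j 1)) i
      - Complex.I * wirtinger (B (0, Pi.single j Complex.I)) i) / 2 := rfl
    rw [hcj, hZj]; ring
  have hz1 := sum_symm_mul_antisymm_eq_zero Z (fun i j => N j i) hZsymm (fun i j => hN j i)
  have hz2 := sum_symm_mul_antisymm_eq_zero (fun i j => c i * c j) (fun i j => N' j i)
    (fun i j => mul_comm _ _) (fun i j => hN' j i)
  simp only [hqq, hxx]
  simp only [Finset.sum_add_distrib, Finset.sum_sub_distrib, ← Finset.mul_sum, ← Finset.sum_mul]
  simp only [hz1, hz2]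
  ring

/-- The vector `u` of the Weierstrass representation. -/
noncomputable def weierstrassVec {n : ℕ} (M : ℂ → Matrix (Fin (n + 1)) (Fin (n + 1)) ℂ)
    (p : ℝ × (Fin n → ℂ)) (ζ : ℂ) : Fin n → ℂ :=
  fun i => p.2 i - 2 * Complex.I * M ζ 0 i.succ * (p.1 : ℂ)
    - ∑ j : Fin n, (M ζ i.succ j.succ - M ζ 0 i.succ * M ζ 0 j.succ) * (starRingEnd ℂ) (p.2 j)

theorem differentiable_weierstrassVec {n : ℕ} {M : ℂ → Matrix (Fin (n + 1)) (Fin (n + 1)) ℂ}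
    (hM : ∀ i j, Differentiable ℂ (fun ζ => M ζ i j)) :
    Differentiable ℝ fun w : (ℝ × (Fin n → ℂ)) × ℂ => weierstrassVec M w.1 w.2 := by
  have hMr : ∀ i j, Differentiable ℝ (fun w : (ℝ × (Fin n → ℂ)) × ℂ => M w.2 i j) :=
    fun i j => ((hM i j).restrictScalars ℝ).comp differentiable_snd
  have hof : Differentiable ℝ fun w : (ℝ × (Fin n → ℂ)) × ℂ => ((w.1.1 : ℝ) : ℂ) :=
    Complex.ofRealCLM.differentiable.comp (by fun_prop)
  have hconj : ∀ j, Differentiable ℝ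
      fun w : (ℝ × (Fin n → ℂ)) × ℂ => (starRingEnd ℂ) (w.1.2 j) := fun j =>
    Complex.conjCLE.differentiable.comp (f := fun w : (ℝ × (Fin n → ℂ)) × ℂ => w.1.2 j)
      (by fun_prop)
  refine differentiable_pi.2 fun i => ?_
  unfold weierstrassVec
  fun_prop (disch := assumption)

theorem weierstrassVec_add_smul {n : ℕ} (M : ℂ → Matrix (Fin (n + 1)) (Fin (n + 1)) ℂ)
    (p h : ℝ × (Fin n → ℂ)) (t : ℝ) (ζ : ℂ) :
    weierstrassVec M (p + t • h) ζ = weierstrassVec M p ζ + t • weierstrassVec M h ζ := by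
  funext i
  simp only [weierstrassVec, Prod.fst_add, Prod.snd_add, Prod.smul_fst, Prod.smul_snd,
    Pi.add_apply, Pi.smul_apply, smul_eq_mul, Complex.real_smul, map_add, map_mul,
    Complex.conj_ofReal, Complex.ofReal_add, Complex.ofReal_mul, mul_add,
    Finset.sum_add_distrib, mul_sub, Finset.mul_sum]
  rw [Finset.sum_congr rfl fun j _ => mul_left_comm _ (t : ℂ) _]
  ring

/-- Implicit differentiation of `Φ (u(p, z p), z p) = 0`. -/
theorem exists_coeff_fderiv_eq {n : ℕ} {M : ℂ → Matrix (Fin (n + 1)) (Fin (n + 1)) ℂ}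
    (hM : ∀ i j, Differentiable ℂ (fun ζ => M ζ i j))
    {Φ : ((Fin n → ℂ) × ℂ) → ℂ} (hΦ : Differentiable ℂ Φ)
    {z : ℝ × (Fin n → ℂ) → ℂ} {p : ℝ × (Fin n → ℂ)} (hz : DifferentiableAt ℝ z p)
    (hsol : ∀ᶠ p' in nhds p, Φ (weierstrassVec M p' (z p'), z p') = 0)
    (hreg : deriv (fun ζ => Φ (weierstrassVec M p ζ, ζ)) (z p) ≠ 0) :
    ∃ c : Fin n → ℂ, ∀ h, fderiv ℝ z p h = ∑ i, c i * weierstrassVec M h (z p) i := by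
  set G : (ℝ × (Fin n → ℂ)) × ℂ → ℂ := fun w => Φ (weierstrassVec M w.1 w.2, w.2) with hG
  have hΦr : Differentiable ℝ Φ := hΦ.restrictScalars ℝ
  have hGd : Differentiable ℝ G :=
    hΦr.comp ((differentiable_weierstrassVec hM).prodMk differentiable_snd)
  have hGat := (hGd (p, z p)).hasFDerivAt
  have h0 : ∀ h, fderiv ℝ G (p, z p) (h, fderiv ℝ z p h) = 0 := by
    intro h
    have h1 : HasFDerivAt (fun p' => G (p', z p'))
        ((fderiv ℝ G (p, z p)).comp ((ContinuousLinearMap.id ℝ _).prod (fderiv ℝ z p))) p :=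
      HasFDerivAt.comp (g := G) (f := fun p' => (p', z p')) p hGat ((hasFDerivAt_id p).prodMk hz.hasFDerivAt)
    have h2 : HasFDerivAt (fun p' => G (p', z p')) (0 : ℝ × (Fin n → ℂ) →L[ℝ] ℂ) p :=
      (hasFDerivAt_const (0 : ℂ) p).congr_of_eventuallyEq hsol
    have := congrArg (fun L => L h) (h1.unique h2)
    simpa using this
  set K := deriv (fun ζ => Φ (weierstrassVec M p ζ, ζ)) (z p) with hK
  have hvert : ∀ w, fderiv ℝ G (p, z p) (0, w) = K * w := by
    intro w
    have hd : DifferentiableAt ℂ (fun ζ => Φ (weierstrassVec M p ζ, ζ)) (z p) := by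
      refine (hΦ _).comp (z p) (DifferentiableAt.prodMk ?_ differentiableAt_id)
      refine differentiableAt_pi.2 fun i => ?_
      have hM' : ∀ i j, DifferentiableAt ℂ (fun ζ => M ζ i j) (z p) := fun i j => hM i j _
      unfold weierstrassVec
      fun_prop (disch := assumption)
    have h1 : HasFDerivAt (fun ζ => G (p, ζ))
        ((fderiv ℝ G (p, z p)).comp (ContinuousLinearMap.inr ℝ _ _)) (z p) :=
      HasFDerivAt.comp (z p) hGat (hasFDerivAt_prodMk_right p (z p))
    have h2 := hd.hasDerivAt.hasFDerivAt.restrictScalars ℝ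
    have := congrArg (fun L => L w) (h1.unique h2)
    simpa [mul_comm] using this
  have hhor : ∀ h, fderiv ℝ G (p, z p) (h, 0)
      = ∑ i, fderiv ℂ Φ (weierstrassVec M p (z p), z p) (Pi.single i 1, 0)
          * weierstrassVec M h (z p) i := by
    intro h
    have hline : HasDerivAt (fun t : ℝ => ((p + t • h, z p) : (ℝ × (Fin n → ℂ)) × ℂ)) (h, 0) 0 := by
      have : HasDerivAt (fun t : ℝ => p + t • h) h 0 := by
        simpa using ((hasDerivAt_id (0 : ℝ)).smul_const h).const_add p
      exact this.prodMk (hasDerivAt_const _ _)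
    have h1 : HasDerivAt (fun t : ℝ => G (p + t • h, z p)) (fderiv ℝ G (p, z p) (h, 0)) 0 := by
      refine HasFDerivAt.comp_hasDerivAt (l := G) (f := fun t : ℝ => (p + t • h, z p)) 0 ?_ hline
      simpa using hGat
    have hline' : HasDerivAt (fun t : ℝ =>
        ((weierstrassVec M (p + t • h) (z p), z p) : (Fin n → ℂ) × ℂ))
        (weierstrassVec M h (z p), 0) 0 := by
      have : HasDerivAt (fun t : ℝ => weierstrassVec M (p + t • h) (z p))
          (weierstrassVec M h (z p)) 0 := by
        simp only [weierstrassVec_add_smul]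
        simpa using ((hasDerivAt_id (0 : ℝ)).smul_const (weierstrassVec M h (z p))).const_add
          (weierstrassVec M p (z p))
      exact this.prodMk (hasDerivAt_const _ _)
    have h2 : HasDerivAt (fun t : ℝ => G (p + t • h, z p))
        (((fderiv ℂ Φ (weierstrassVec M p (z p), z p)).restrictScalars ℝ)
          (weierstrassVec M h (z p), 0)) 0 := by
      refine HasFDerivAt.comp_hasDerivAt (l := Φ)
        (f := fun t : ℝ => (weierstrassVec M (p + t • h) (z p), z p)) 0 ?_ hline'
      simpa using (hΦ _).hasFDerivAt.restrictScalars ℝ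
    rw [h1.unique h2, ContinuousLinearMap.coe_restrictScalars']
    have hv : ((weierstrassVec M h (z p), 0) : (Fin n → ℂ) × ℂ)
        = ∑ i, weierstrassVec M h (z p) i • ((Pi.single i 1, 0) : (Fin n → ℂ) × ℂ) := by
      refine Prod.ext ?_ ?_
      · rw [Prod.fst_sum]
        exact pi_eq_sum_univ' _
      · simp [Prod.snd_sum]
    rw [hv, map_sum]
    exact Finset.sum_congr rfl fun i _ => by rw [map_smul, smul_eq_mul, mul_comm]
  refine ⟨fun i => -fderiv ℂ Φ (weierstrassVec M p (z p), z p) (Pi.single i 1, 0) / K,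
    fun h => ?_⟩
  have h1 : fderiv ℝ G (p, z p) (h, 0) + fderiv ℝ G (p, z p) (0, fderiv ℝ z p h) = 0 := by
    rw [← map_add]
    simpa using h0 h
  rw [hhor, hvert] at h1
  refine mul_left_cancel₀ hreg ?_
  rw [eq_neg_of_add_eq_zero_right h1, Finset.mul_sum, ← Finset.sum_neg_distrib]
  refine Finset.sum_congr rfl fun i _ => ?_
  field_simp

/-- A form `∑ cᵢ duⁱ` has `cᵢ` as its complex derivatives, and the remaining ones are determined
by these. -/
theorem weierstrass_system_of_coeff {n : ℕ} {M : Matrix (Fin (n + 1)) (Fin (n + 1)) ℂ}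
    {D : ℝ × (Fin n → ℂ) → ℂ} {c : Fin n → ℂ}
    (hD : ∀ h, D h = ∑ i, c i * weierstrassVec (fun _ => M) h 0 i) :
    D (1, 0) = -2 * Complex.I * ∑ i, M 0 i.succ * wirtinger D i ∧
    ∀ j, (D (0, Pi.single j 1) + Complex.I * D (0, Pi.single j Complex.I)) / 2
      = -∑ i, wirtinger D i * (M i.succ j.succ - M 0 i.succ * M 0 j.succ) := by
  have hs : ∀ (j : Fin n) (a : ℂ), D (0, Pi.single j a)
      = c j * a - (∑ i, c i * (M i.succ j.succ - M 0 i.succ * M 0 j.succ))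
        * (starRingEnd ℂ) a := by
    intro j a
    have hc : ∀ k, (starRingEnd ℂ) ((Pi.single j a : Fin n → ℂ) k)
        = if k = j then (starRingEnd ℂ) a else 0 := fun k => by
      rw [Pi.single_apply]; split_ifs <;> simp
    have hc' : ∀ k, (Pi.single j a : Fin n → ℂ) k = if k = j then a else 0 := fun k => by
      rw [Pi.single_apply]
    rw [hD]
    simp only [weierstrassVec, hc]
    simp only [hc', Complex.ofReal_zero, mul_zero, sub_zero, mul_ite, Finset.sum_ite_eq',
      Finset.mem_univ, if_true, mul_sub, Finset.sum_sub_distrib,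
      sub_mul, Finset.sum_mul, mul_assoc]
  have hw : ∀ i, wirtinger D i = c i := by
    intro i
    simp only [wirtinger, hs, map_one, Complex.conj_I]
    linear_combination (-(c i) / 2
      - (∑ k, c k * (M k.succ i.succ - M 0 k.succ * M 0 i.succ)) / 2) * Complex.I_sq
  refine ⟨?_, fun j => ?_⟩
  · rw [hD, Finset.mul_sum]
    refine Finset.sum_congr rfl fun i _ => ?_
    rw [hw]
    simp [weierstrassVec]
    ring
  · simp only [hw, hs, map_one, Complex.conj_I]
    linear_combination (c j / 2
      + (∑ k, c k * (M k.succ j.succ - M 0 k.succ * M 0 j.succ)) / 2) * Complex.I_sq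

/-- The Weierstrass representation on `ℝ^{2m−1} ≅ ℝ × ℂ^{m−1}`.
Here the paper's `m` is `n + 1` (so `n ≥ 1` encodes `m ≥ 2`); the matrix `M`
is indexed by `Fin (n+1)` (paper indices `1, …, m`), the coordinates are
`(x², q², …, q^m) ∈ ℝ × ℂ^n`, and `μ_{i−1}(ζ) = M(ζ)_{1,i}` corresponds to
`M ζ 0 i.succ`. Any C² local solution `z` of `Φ̃(x², q, z) = 0` with
nonvanishing `ζ`-derivative is a harmonic morphism: the sum of the squares of
its `2m−1 = 2n+1` coordinate partial derivatives vanishes and its Laplacian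
vanishes. -/
theorem weierstrass_odd_gives_harmonic_morphism
    (n : ℕ) (hn : 1 ≤ n)
    (M : ℂ → Matrix (Fin (n + 1)) (Fin (n + 1)) ℂ)
    (hM : ∀ i j, Differentiable ℂ (fun ζ => M ζ i j))
    (hManti : ∀ ζ, (M ζ)ᵀ = -(M ζ))
    (Φ : ((Fin n → ℂ) × ℂ) → ℂ) (hΦ : Differentiable ℂ Φ)
    (U : Set (ℝ × (Fin n → ℂ))) (hU : IsOpen U)
    (z : ℝ × (Fin n → ℂ) → ℂ) (hz : ContDiffOn ℝ 2 z U)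
    (hsol : ∀ p ∈ U,
      Φ ((fun i : Fin n => p.2 i - 2 * Complex.I * M (z p) 0 i.succ * (p.1 : ℂ)
            - ∑ j : Fin n, (M (z p) i.succ j.succ
                - M (z p) 0 i.succ * M (z p) 0 j.succ) * (starRingEnd ℂ) (p.2 j)),
          z p) = 0)
    (hreg : ∀ p ∈ U,
      deriv (fun ζ =>
        Φ ((fun i : Fin n => p.2 i - 2 * Complex.I * M ζ 0 i.succ * (p.1 : ℂ)
              - ∑ j : Fin n, (M ζ i.succ j.succ
                  - M ζ 0 i.succ * M ζ 0 j.succ) * (starRingEnd ℂ) (p.2 j)),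
            ζ)) (z p) ≠ 0) :
    ∀ p ∈ U,
      ((fderiv ℝ z p ((1 : ℝ), (0 : Fin n → ℂ))) ^ 2
        + ∑ j, ((fderiv ℝ z p ((0 : ℝ), Pi.single j 1)) ^ 2
              + (fderiv ℝ z p ((0 : ℝ), Pi.single j Complex.I)) ^ 2) = 0) ∧
      (fderiv ℝ (fun p' => fderiv ℝ z p' ((1 : ℝ), (0 : Fin n → ℂ))) p
          ((1 : ℝ), (0 : Fin n → ℂ))
        + ∑ j, (fderiv ℝ (fun p' => fderiv ℝ z p' ((0 : ℝ), Pi.single j 1)) p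
              ((0 : ℝ), Pi.single j 1)
            + fderiv ℝ (fun p' => fderiv ℝ z p' ((0 : ℝ), Pi.single j Complex.I)) p
              ((0 : ℝ), Pi.single j Complex.I)) = 0) := by
  have hzd : ∀ p ∈ U, ContDiffAt ℝ 2 z p := fun p hp => hz.contDiffAt (hU.mem_nhds hp)
  have hsys : ∀ p ∈ U,
      (fderiv ℝ z p (1, 0)
        = -2 * Complex.I * ∑ i, M (z p) 0 i.succ * wirtinger (fderiv ℝ z p) i) ∧
      ∀ j, (fderiv ℝ z p (0, Pi.single j 1)
          + Complex.I * fderiv ℝ z p (0, Pi.single j Complex.I)) / 2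
        = -∑ i, wirtinger (fderiv ℝ z p) i
            * (M (z p) i.succ j.succ - M (z p) 0 i.succ * M (z p) 0 j.succ) := by
    intro p hp
    obtain ⟨c, hc⟩ := exists_coeff_fderiv_eq hM hΦ ((hzd p hp).differentiableAt (by norm_num))
      (Filter.eventually_of_mem (hU.mem_nhds hp) hsol) (hreg p hp)
    exact weierstrass_system_of_coeff (M := M (z p)) hc
  have hanti : ∀ ζ i j, M ζ i j = -M ζ j i := fun ζ i j => by
    simpa using congrFun (congrFun (hManti ζ) j) i
  intro p hp
  refine ⟨sum_sq_eq_zero_of_weierstrass _ (fun i => M (z p) 0 i.succ)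
    (fun i j => M (z p) i.succ j.succ) (fun i j => hanti _ _ _) (hsys p hp).1 (hsys p hp).2, ?_⟩
  have hz' : DifferentiableAt ℝ z p := (hzd p hp).differentiableAt (by norm_num)
  have hD2 : HasFDerivAt (fderiv ℝ z) (fderiv ℝ (fderiv ℝ z) p) p :=
    (((hzd p hp).fderiv_right (m := 1) (by norm_num)).differentiableAt (by norm_num)).hasFDerivAt
  set B := fderiv ℝ (fderiv ℝ z) p with hBdef
  have hBsymm : ∀ v w, B v w = B w v :=
    (hzd p hp).isSymmSndFDerivAt (by simp)
  have hBv : ∀ v w, fderiv ℝ (fun p' => fderiv ℝ z p' v) p w = B w v := by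
    intro v w
    have h1 : HasFDerivAt (fun p' => fderiv ℝ z p' v)
        ((ContinuousLinearMap.apply ℝ ℂ v).comp B) p :=
      (ContinuousLinearMap.apply ℝ ℂ v).hasFDerivAt.comp p hD2
    rw [h1.fderiv]; rfl
  have hline : ∀ h : ℝ × (Fin n → ℂ), HasDerivAt (fun t : ℝ => p + t • h) h 0 := fun h => by
    simpa using ((hasDerivAt_id (0 : ℝ)).smul_const h).const_add p
  have hp0 : ∀ h : ℝ × (Fin n → ℂ), p + (0 : ℝ) • h = p := fun h => by simp
  have hDv : ∀ v h, HasDerivAt (fun t : ℝ => fderiv ℝ z (p + t • h) v) (B h v) 0 := by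
    intro v h
    have h1 : HasDerivAt (fun t : ℝ => fderiv ℝ z (p + t • h)) (B h) 0 :=
      HasFDerivAt.comp_hasDerivAt (l := fderiv ℝ z) (f := fun t : ℝ => p + t • h) 0
        ((hp0 h).symm ▸ hD2) (hline h)
    exact (ContinuousLinearMap.apply ℝ ℂ v).hasFDerivAt.comp_hasDerivAt 0 h1
  have hwv : ∀ i h, HasDerivAt (fun t : ℝ => wirtinger (fderiv ℝ z (p + t • h)) i)
      (wirtinger (B h) i) 0 := fun i h =>
    ((hDv _ h).sub ((hDv _ h).const_mul Complex.I)).div_const 2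
  have hMv : ∀ i j h, HasDerivAt (fun t : ℝ => M (z (p + t • h)) i j)
      (deriv (fun ζ => M ζ i j) (z p) * fderiv ℝ z p h) 0 := by
    intro i j h
    have h1 : HasDerivAt (fun t : ℝ => z (p + t • h)) (fderiv ℝ z p h) 0 :=
      HasFDerivAt.comp_hasDerivAt (l := z) (f := fun t : ℝ => p + t • h) 0
        ((hp0 h).symm ▸ hz'.hasFDerivAt) (hline h)
    refine HasDerivAt.comp (h₂ := fun ζ => M ζ i j) (h := fun t : ℝ => z (p + t • h)) 0 ?_ h1
    simpa using (hM i j (z p)).hasDerivAt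
  have hU' : ∀ h, ∀ᶠ t in nhds (0 : ℝ), p + t • h ∈ U := fun h =>
    (hline h).continuousAt.eventually_mem ((hp0 h).symm ▸ hU.mem_nhds hp)
  simp only [hBv]
  refine trace_eq_zero_of_weierstrass (fun v w => B v w) (fderiv ℝ z p)
    (fun i => M (z p) 0 i.succ) (fun i => deriv (fun ζ => M ζ 0 i.succ) (z p))
    (fun i j => M (z p) i.succ j.succ) (fun i j => deriv (fun ζ => M ζ i.succ j.succ) (z p))
    hBsymm (fun i j => hanti _ _ _) (fun i j => ?_) (hsys p hp).1 (fun h => ?_) (fun j h => ?_)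
  · rw [← deriv.fun_neg]
    exact congrArg (fun f => deriv f (z p)) (funext fun ζ => hanti ζ _ _)
  · have h1 := (HasDerivAt.fun_sum (u := Finset.univ) fun i _ =>
      (hMv 0 (Fin.succ i) h).mul (hwv i h)).const_mul (-2 * Complex.I)
    have h2 := (hDv (1, 0) h).congr_of_eventuallyEq
      ((hU' h).mono fun t ht => (hsys _ ht).1.symm)
    refine (h2.unique h1).trans ?_
    simp only [hp0]
  · have h1 := (HasDerivAt.fun_sum (u := Finset.univ) fun i _ =>
      (hwv i h).mul ((hMv (Fin.succ i) (Fin.succ j) h).sub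
        ((hMv 0 (Fin.succ i) h).mul (hMv 0 (Fin.succ j) h)))).neg
    have h2 := (((hDv (0, Pi.single j 1) h).add
      ((hDv (0, Pi.single j Complex.I) h).const_mul Complex.I)).div_const 2).congr_of_eventuallyEq
      ((hU' h).mono fun t ht => ((hsys _ ht).2 j).symm)
    refine (h2.unique h1).trans ?_
    simp only [Pi.sub_apply, Pi.mul_apply, hp0]
    exact congrArg Neg.neg (Finset.sum_congr rfl fun i _ => by ring)
end

section
/- Let μ : ℂ → ℂ and Φ : ℂ × ℂ → ℂ be holomorphic, let U ⊆ ℝ × ℂ ≅ ℝ³ be open, and let z : U → ℂ be a C² function such that for all (x, q) ∈ U, Φ(q − 2i·μ(z(x,q))·x + μ(z(x,q))²·q̄, z(x,q)) = 0, and the complex derivative of ζ ↦ Φ(q − 2i·μ(ζ)·x + μ(ζ)²·q̄, ζ) is nonzero at ζ = z(x,q). Then z is a harmonic morphism on U ⊆ ℝ³: (∂z/∂x)² + (∂z/∂x³)² + (∂z/∂x⁴)² = 0 and ∂²z/∂x² + ∂²z/∂(x³)² + ∂²z/∂(x⁴)² = 0 at every point of U. -/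
/-- A solution of the implicit Weierstrass equation has gradient proportional to the isotropic
vector `(-2iμ, 1 + μ², i(1 - μ²))`. -/
lemma exists_fderiv_eq_smul_isotropic {μ : ℂ → ℂ} (hμ : Differentiable ℂ μ)
    {Φ : ℂ × ℂ → ℂ} (hΦ : Differentiable ℂ Φ) {z : ℝ × ℂ → ℂ} {p : ℝ × ℂ}
    (hz : DifferentiableAt ℝ z p)
    (hsol : ∀ᶠ p in nhds p, Φ (p.2 - 2 * Complex.I * μ (z p) * (p.1 : ℂ)
      + μ (z p) ^ 2 * (starRingEnd ℂ) p.2, z p) = 0)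
    (hreg : deriv (fun ζ => Φ (p.2 - 2 * Complex.I * μ ζ * (p.1 : ℂ)
      + μ ζ ^ 2 * (starRingEnd ℂ) p.2, ζ)) (z p) ≠ 0) :
    ∃ l : ℂ, ∀ u : ℝ × ℂ, fderiv ℝ z p u =
      l * (u.2 - 2 * Complex.I * μ (z p) * (u.1 : ℂ) + μ (z p) ^ 2 * (starRingEnd ℂ) u.2) := by
  have hΦ' := (hΦ (p.2 - 2 * Complex.I * μ (z p) * (p.1 : ℂ)
    + μ (z p) ^ 2 * (starRingEnd ℂ) p.2, z p)).hasFDerivAt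
  set L := fderiv ℂ Φ (p.2 - 2 * Complex.I * μ (z p) * (p.1 : ℂ)
    + μ (z p) ^ 2 * (starRingEnd ℂ) p.2, z p)
  have hL : ∀ a b : ℂ, L (a, b) = a * L (1, 0) + b * L (0, 1) := by
    intro a b
    have h : ((a, b) : ℂ × ℂ) = a • (1, 0) + b • (0, 1) := by simp
    rw [h, map_add, map_smul, map_smul, smul_eq_mul, smul_eq_mul]
  have hμz := (hμ (z p)).hasDerivAt
  have hW := ((((hμz.const_mul (2 * Complex.I)).mul_const (p.1 : ℂ)).const_sub p.2).add
    ((hμz.pow 2).mul_const ((starRingEnd ℂ) p.2))).prodMk (hasDerivAt_id (z p))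
  have hD := (HasFDerivAt.comp_hasDerivAt_of_eq (z p) hΦ' hW rfl).deriv
  have hD' : deriv (fun ζ => Φ (p.2 - 2 * Complex.I * μ ζ * (p.1 : ℂ)
      + μ ζ ^ 2 * (starRingEnd ℂ) p.2, ζ)) (z p) = _ := hD
  rw [hD', hL] at hreg
  have hx : HasFDerivAt (fun p : ℝ × ℂ => (p.1 : ℂ))
      (Complex.ofRealCLM.comp (ContinuousLinearMap.fst ℝ ℝ ℂ)) p :=
    (Complex.ofRealCLM.comp (ContinuousLinearMap.fst ℝ ℝ ℂ)).hasFDerivAt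
  have hq : HasFDerivAt (fun p : ℝ × ℂ => p.2) (ContinuousLinearMap.snd ℝ ℝ ℂ) p :=
    hasFDerivAt_snd
  have hqbar : HasFDerivAt (fun p : ℝ × ℂ => (starRingEnd ℂ) p.2)
      ((Complex.conjCLE : ℂ →L[ℝ] ℂ).comp (ContinuousLinearMap.snd ℝ ℝ ℂ)) p :=
    ((Complex.conjCLE : ℂ →L[ℝ] ℂ).comp (ContinuousLinearMap.snd ℝ ℝ ℂ)).hasFDerivAt
  have hm : HasFDerivAt (fun p => μ (z p)) (deriv μ (z p) • fderiv ℝ z p) p :=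
    hμz.comp_hasFDerivAt_of_eq p hz.hasFDerivAt rfl
  have hG := ((hq.sub ((hm.const_mul (2 * Complex.I)).mul hx)).add
    ((hm.pow 2).mul hqbar)).prodMk hz.hasFDerivAt
  have h0 := (HasFDerivAt.comp (f := fun p => (p.2 - 2 * Complex.I * μ (z p) * (p.1 : ℂ)
    + μ (z p) ^ 2 * (starRingEnd ℂ) p.2, z p)) p (hΦ'.restrictScalars ℝ) hG).unique
    ((hasFDerivAt_const (0 : ℂ) p).congr_of_eventuallyEq hsol)
  refine ⟨-L (1, 0) / ((-(2 * Complex.I * deriv μ (z p) * p.1)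
    + 2 * μ (z p) * deriv μ (z p) * (starRingEnd ℂ) p.2) * L (1, 0) + L (0, 1)), fun u => ?_⟩
  have h := DFunLike.congr_fun h0 u
  simp at h hreg
  rw [hL] at h
  rw [div_mul_eq_mul_div, eq_div_iff hreg]
  linear_combination h

/-- A `C²` function `z` near `p` whose gradient is everywhere proportional to the isotropic vector
`(-2iμ, 1 + μ², i(1 - μ²))`, with `μ` evaluated at `z`, is harmonic at `p`. -/
lemma laplacian_eq_zero_of_fderiv_eq_smul_isotropic {μ : ℂ → ℂ} (hμ : Differentiable ℂ μ)
    {z : ℝ × ℂ → ℂ} {p : ℝ × ℂ} (hz : ContDiffAt ℝ 2 z p)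
    (hgrad : ∀ᶠ p in nhds p, ∃ l : ℂ, ∀ u : ℝ × ℂ, fderiv ℝ z p u =
      l * (u.2 - 2 * Complex.I * μ (z p) * (u.1 : ℂ) + μ (z p) ^ 2 * (starRingEnd ℂ) u.2)) :
    fderiv ℝ (fun p' => fderiv ℝ z p' ((1 : ℝ), (0 : ℂ))) p ((1 : ℝ), (0 : ℂ))
      + fderiv ℝ (fun p' => fderiv ℝ z p' ((0 : ℝ), (1 : ℂ))) p ((0 : ℝ), (1 : ℂ))
      + fderiv ℝ (fun p' => fderiv ℝ z p' ((0 : ℝ), Complex.I)) p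
          ((0 : ℝ), Complex.I) = 0 := by
  have hI := Complex.I_sq
  have hsymm : ∀ u v, fderiv ℝ (fderiv ℝ z) p u v = fderiv ℝ (fderiv ℝ z) p v u :=
    fun u v => (hz.isSymmSndFDerivAt (by simp)).eq u v
  have hzd : HasFDerivAt z (fderiv ℝ z p) p := (hz.differentiableAt (by simp)).hasFDerivAt
  have hdz : HasFDerivAt (fderiv ℝ z) (fderiv ℝ (fderiv ℝ z) p) p :=
    ((hz.fderiv_right (m := 1) le_rfl).differentiableAt (by simp)).hasFDerivAt
  have hd : ∀ v, HasFDerivAt (fun p' => fderiv ℝ z p' v)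
      ((fderiv ℝ (fderiv ℝ z) p).flip v) p := fun v =>
    (ContinuousLinearMap.apply ℝ ℂ v).hasFDerivAt.comp p hdz
  have hm : HasFDerivAt (fun p => μ (z p)) (deriv μ (z p) • fderiv ℝ z p) p :=
    (hμ (z p)).hasDerivAt.comp_hasFDerivAt_of_eq p hzd rfl
  have hl := ((hd (0, 1)).sub ((hd (0, Complex.I)).const_mul Complex.I)).const_mul (1 / 2)
  have hx := (hd (1, 0)).unique (((hm.mul hl).const_mul (-2 * Complex.I)).congr_of_eventuallyEq
    (by
      filter_upwards [hgrad] with p' ⟨l, h⟩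
      simp [h]
      linear_combination (Complex.I * μ (z p') * l * (1 - μ (z p') ^ 2)) * hI))
  have hqbar := ((hd (0, 1)).add ((hd (0, Complex.I)).const_mul Complex.I)).unique
    ((((hm.pow 2).mul hl).const_mul 2).congr_of_eventuallyEq
    (by
      filter_upwards [hgrad] with p' ⟨l, h⟩
      simp [h]
      linear_combination l * (1 - μ (z p') ^ 2 + μ (z p') ^ 2 * (1 - μ (z p') ^ 2)) * hI))
  have hx' := fun u => DFunLike.congr_fun hx u
  have hqbar' := fun u => DFunLike.congr_fun hqbar u
  obtain ⟨l, h⟩ := hgrad.self_of_nhds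
  rw [(hd _).fderiv, (hd _).fderiv, (hd _).fderiv]
  have hxx := hx' (1, 0)
  have h1x := hx' (0, 1)
  have hix := hx' (0, Complex.I)
  have h1 := hqbar' (0, 1)
  have hi := hqbar' (0, Complex.I)
  simp [h] at hxx h1x hix h1 hi ⊢
  rw [hsymm (0, 1) (1, 0)] at h1x
  rw [hsymm (0, Complex.I) (1, 0)] at hix
  rw [hsymm (0, Complex.I) (0, 1)] at hi hix
  linear_combination hxx + h1 - Complex.I * hi - Complex.I * μ (z p) * h1x - μ (z p) * hix
    + (fderiv ℝ (fderiv ℝ z) p (0, 1) (0, 1) * μ (z p) ^ 2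
      + fderiv ℝ (fderiv ℝ z) p (0, Complex.I) (0, Complex.I)
      - Complex.I * μ (z p) ^ 2 * fderiv ℝ (fderiv ℝ z) p (0, 1) (0, Complex.I)
      + μ (z p) * fderiv ℝ (fderiv ℝ z) p (1, 0) (0, Complex.I)
      + l ^ 2 * deriv μ (z p) * (4 * μ (z p) ^ 3 + 2 * μ (z p) * (1 - Complex.I ^ 2)
        + 2 * μ (z p) ^ 5 * (1 + Complex.I ^ 2))) * hI

/-- Example 3.5 of the paper — the classical Weierstrass-type
representation of harmonic morphisms on domains of `ℝ³ ≅ ℝ × ℂ` (coordinates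
`(x, q)` with `q = x³ + i·x⁴`). Any C² local solution `z` of
`Φ(q − 2i·μ(z)·x + μ(z)²·q̄, z) = 0` with nonvanishing `ζ`-derivative is a
harmonic morphism. -/
theorem weierstrass_R3_gives_harmonic_morphism
    (μ : ℂ → ℂ) (hμ : Differentiable ℂ μ)
    (Φ : ℂ × ℂ → ℂ) (hΦ : Differentiable ℂ Φ)
    (U : Set (ℝ × ℂ)) (hU : IsOpen U)
    (z : ℝ × ℂ → ℂ) (hz : ContDiffOn ℝ 2 z U)
    (hsol : ∀ p ∈ U,
      Φ (p.2 - 2 * Complex.I * μ (z p) * (p.1 : ℂ)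
          + μ (z p) ^ 2 * (starRingEnd ℂ) p.2, z p) = 0)
    (hreg : ∀ p ∈ U,
      deriv (fun ζ => Φ (p.2 - 2 * Complex.I * μ ζ * (p.1 : ℂ)
          + μ ζ ^ 2 * (starRingEnd ℂ) p.2, ζ)) (z p) ≠ 0) :
    ∀ p ∈ U,
      ((fderiv ℝ z p ((1 : ℝ), (0 : ℂ))) ^ 2
        + (fderiv ℝ z p ((0 : ℝ), (1 : ℂ))) ^ 2
        + (fderiv ℝ z p ((0 : ℝ), Complex.I)) ^ 2 = 0) ∧
      (fderiv ℝ (fun p' => fderiv ℝ z p' ((1 : ℝ), (0 : ℂ))) p ((1 : ℝ), (0 : ℂ))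
        + fderiv ℝ (fun p' => fderiv ℝ z p' ((0 : ℝ), (1 : ℂ))) p ((0 : ℝ), (1 : ℂ))
        + fderiv ℝ (fun p' => fderiv ℝ z p' ((0 : ℝ), Complex.I)) p
            ((0 : ℝ), Complex.I) = 0) := by
  intro p hp
  have hgrad : ∀ p ∈ U, ∃ l : ℂ, ∀ u : ℝ × ℂ, fderiv ℝ z p u =
      l * (u.2 - 2 * Complex.I * μ (z p) * (u.1 : ℂ) + μ (z p) ^ 2 * (starRingEnd ℂ) u.2) :=
    fun p hp => exists_fderiv_eq_smul_isotropic hμ hΦ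
      ((hz.contDiffAt (hU.mem_nhds hp)).differentiableAt (by simp))
      (by filter_upwards [hU.mem_nhds hp] with p' hp' using hsol p' hp') (hreg p hp)
  refine ⟨?_, laplacian_eq_zero_of_fderiv_eq_smul_isotropic hμ (hz.contDiffAt (hU.mem_nhds hp))
    (by filter_upwards [hU.mem_nhds hp] with p' hp' using hgrad p' hp')⟩
  obtain ⟨l, h⟩ := hgrad p hp
  simp [h]
  linear_combination (l ^ 2 * (1 + μ (z p) ^ 2) ^ 2) * Complex.I_sq
end

section
/- Let μ₁, μ₂, μ₃ : ℂ → ℂ be holomorphic, let U ⊆ ℂ³ \ {0} ≅ ℝ⁶ \ {0} be open, and let z : U → ℂ be a C² function such that at every q ∈ U: (q¹ − μ₁(z)·q̄² − μ₂(z)·q̄³)² = z²·[ (q² + μ₁(z)·q̄¹ − μ₃(z)·q̄³)² + (q³ + μ₂(z)·q̄¹ + μ₃(z)·q̄²)² ] (with z = z(q)), and the complex derivative of ζ ↦ (q¹ − μ₁(ζ)q̄² − μ₂(ζ)q̄³)² − ζ²·[(q² + μ₁(ζ)q̄¹ − μ₃(ζ)q̄³)² + (q³ + μ₂(ζ)q̄¹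 + μ₃(ζ)q̄²)²] is nonzero at ζ = z(q). Then z is a harmonic morphism — Σ_{j=1}^{6} (∂z/∂x^j)² = 0 and Σ_{j=1}^{6} ∂²z/(∂x^j)² = 0 — and z is invariant under radial projection: Σ_{j=1}^{6} x^j · ∂z/∂x^j = 0 at every point of U, so z is constant along rays through the origin. -/
open Filter Topology

/-- First- and second-order consequences of the vanishing of
`f (ζ t) + t * g (ζ t) + t ^ 2 * h (ζ t)` near `t = 0`. -/
lemma implicit_quadratic_derivatives {f g h : ℂ → ℂ} (hf : Differentiable ℂ f)
    (hg : Differentiable ℂ g) (hh : Differentiable ℂ h) {ζ ζ₁ : ℝ → ℂ} {ζ₂ : ℂ}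
    (hζ : ∀ᶠ t in 𝓝 (0 : ℝ), HasDerivAt ζ (ζ₁ t) t) (hζ₁ : HasDerivAt ζ₁ ζ₂ 0)
    (hzero : ∀ᶠ t in 𝓝 (0 : ℝ), f (ζ t) + (t : ℂ) * g (ζ t) + (t : ℂ) ^ 2 * h (ζ t) = 0) :
    deriv f (ζ 0) * ζ₁ 0 + g (ζ 0) = 0 ∧
      deriv (deriv f) (ζ 0) * ζ₁ 0 ^ 2 + deriv f (ζ 0) * ζ₂ + 2 * (deriv g (ζ 0) * ζ₁ 0)
        + 2 * h (ζ 0) = 0 := by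
  have comp : ∀ {k : ℂ → ℂ}, Differentiable ℂ k → ∀ {t : ℝ}, HasDerivAt ζ (ζ₁ t) t →
      HasDerivAt (fun s => k (ζ s)) (deriv k (ζ t) * ζ₁ t) t := fun hk _ ht =>
    (hk _).hasDerivAt.comp_of_eq _ ht rfl
  have cast : ∀ t : ℝ, HasDerivAt (fun s : ℝ => (s : ℂ)) 1 t := fun t =>
    (hasDerivAt_id t).ofReal_comp
  have first : ∀ᶠ t in 𝓝 (0 : ℝ), deriv f (ζ t) * ζ₁ t
      + (g (ζ t) + (t : ℂ) * (deriv g (ζ t) * ζ₁ t))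
      + (2 * (t : ℂ) * h (ζ t) + (t : ℂ) ^ 2 * (deriv h (ζ t) * ζ₁ t)) = 0 := by
    filter_upwards [hζ, hzero.eventually_nhds] with t ht hz
    have key := ((comp hf ht).add ((cast t).mul (comp hg ht))).add
      (((cast t).pow 2).mul (comp hh ht))
    have h0 := key.unique ((hasDerivAt_const t (0 : ℂ)).congr_of_eventuallyEq
      (by filter_upwards [hz] with s hs using hs))
    simp at h0
    linear_combination h0
  have h0 := hζ.self_of_nhds
  constructor
  · simpa using first.self_of_nhds
  · have key := (((comp hf.deriv h0).mul hζ₁).add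
      ((comp hg h0).add ((cast 0).mul ((comp hg.deriv h0).mul hζ₁)))).add
      ((((cast 0).const_mul 2).mul (comp hh h0)).add
        (((cast 0).pow 2).mul ((comp hh.deriv h0).mul hζ₁)))
    have h1 := key.unique ((hasDerivAt_const (0 : ℝ) (0 : ℂ)).congr_of_eventuallyEq
      (by filter_upwards [first] with s hs using hs))
    simp at h1
    linear_combination h1

lemma directional_derivatives_along_line {E : Type*} [NormedAddCommGroup E] [NormedSpace ℝ E]
    {U : Set E} (hU : IsOpen U) {z : E → ℂ} (hz : ContDiffOn ℝ 2 z U) {q : E} (hq : q ∈ U)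
    (v : E) :
    (∀ᶠ t in 𝓝 (0 : ℝ), q + t • v ∈ U) ∧
    (∀ᶠ t in 𝓝 (0 : ℝ),
      HasDerivAt (fun s : ℝ => z (q + s • v)) (fderiv ℝ z (q + t • v) v) t) ∧
    HasDerivAt (fun t : ℝ => fderiv ℝ z (q + t • v) v)
      (fderiv ℝ (fun p => fderiv ℝ z p v) q v) 0 := by
  have line : ∀ t : ℝ, HasDerivAt (fun s : ℝ => q + s • v) v t := fun t => by
    simpa using ((hasDerivAt_id t).smul_const v).const_add q
  have hmem : ∀ᶠ t in 𝓝 (0 : ℝ), q + t • v ∈ U :=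
    (line 0).continuousAt.eventually_mem (by simpa using hU.mem_nhds hq)
  refine ⟨hmem, ?_, ?_⟩
  · filter_upwards [hmem] with t ht
    exact (((hz.contDiffAt (hU.mem_nhds ht)).differentiableAt
      (by norm_num)).hasFDerivAt).comp_hasDerivAt t (line t)
  · have hd : DifferentiableAt ℝ (fun p => fderiv ℝ z p v) q :=
      (((hz.contDiffAt (hU.mem_nhds hq)).fderiv_right (m := 1) (by norm_num)).differentiableAt
        (by norm_num)).clm_apply (differentiableAt_const v)
    exact hd.hasFDerivAt.comp_hasDerivAt_of_eq 0 (line 0) (by simp)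

/-- An implicitly defined function `F q (z q) = 0`, where `F` is quadratic in `q` and
holomorphic in its second argument, is a harmonic morphism as soon as
each `F · ζ` is one; it is invariant under radial projection. -/
theorem harmonicMorphism_of_implicit_quadratic {E ι : Type*} [NormedAddCommGroup E]
    [NormedSpace ℝ E] [Fintype ι] {U : Set E} (hU : IsOpen U) {z : E → ℂ}
    (hz : ContDiffOn ℝ 2 z U) {F : E → ℂ → ℂ} {P : E → E → ℂ → ℂ}
    (hF : ∀ p, Differentiable ℂ (F p)) (hP : ∀ p v, Differentiable ℂ (P p v))
    (hquad : ∀ p v (t : ℝ) ζ,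
      F (p + t • v) ζ = F p ζ + (t : ℂ) * P p v ζ + (t : ℂ) ^ 2 * F v ζ)
    (hsol : ∀ p ∈ U, F p (z p) = 0) {q : E} (hq : q ∈ U) (hreg : deriv (F q) (z q) ≠ 0)
    (e : ι → E) (x : ι → ℝ) (hconf : ∀ ζ, ∑ i, P q (e i) ζ ^ 2 = 0)
    (hharm : ∀ ζ, ∑ i, F (e i) ζ = 0)
    (hrad : ∀ ζ, ∑ i, (x i : ℂ) * P q (e i) ζ = 2 * F q ζ) :
    ∑ i, fderiv ℝ z q (e i) ^ 2 = 0 ∧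
    ∑ i, fderiv ℝ (fun p => fderiv ℝ z p (e i)) q (e i) = 0 ∧
    ∑ i, (x i : ℂ) * fderiv ℝ z q (e i) = 0 := by
  have key : ∀ v, deriv (F q) (z q) * fderiv ℝ z q v + P q v (z q) = 0 ∧
      deriv (deriv (F q)) (z q) * fderiv ℝ z q v ^ 2
        + deriv (F q) (z q) * fderiv ℝ (fun p => fderiv ℝ z p v) q v
        + 2 * (deriv (P q v) (z q) * fderiv ℝ z q v) + 2 * F v (z q) = 0 := fun v => by
    obtain ⟨hmem, h1, h2⟩ := directional_derivatives_along_line hU hz hq v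
    simpa using implicit_quadratic_derivatives (hF q) (hP q v) (hF v) h1 h2
      (by filter_upwards [hmem] with t ht using by rw [← hquad]; exact hsol _ ht)
  set D := deriv (F q) (z q)
  have hfirst : ∀ i, D * fderiv ℝ z q (e i) = -P q (e i) (z q) := fun i =>
    eq_neg_of_add_eq_zero_left (key (e i)).1
  have hconf' : ∑ i, deriv (P q (e i)) (z q) * P q (e i) (z q) = 0 := by
    have hd := HasDerivAt.fun_sum (u := Finset.univ) fun i _ =>
      (((hP q (e i)) (z q)).hasDerivAt).pow 2
    have h0 := hd.unique ((hasDerivAt_const (z q) (0 : ℂ)).congr_of_eventuallyEq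
      (Eventually.of_forall fun ζ => by simpa using hconf ζ))
    have h1 : 2 * ∑ i, deriv (P q (e i)) (z q) * P q (e i) (z q) = 0 := by
      rw [← h0, Finset.mul_sum]
      exact Finset.sum_congr rfl fun i _ => by push_cast; ring
    simpa using h1
  have hgrad : ∑ i, fderiv ℝ z q (e i) ^ 2 = 0 := by
    have h1 : D ^ 2 * ∑ i, fderiv ℝ z q (e i) ^ 2 = 0 := by
      rw [← hconf (z q), Finset.mul_sum]
      exact Finset.sum_congr rfl fun i _ => by rw [← mul_pow, hfirst, neg_sq]
    exact (mul_eq_zero.mp h1).resolve_left (pow_ne_zero 2 hreg)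
  refine ⟨hgrad, ?_, ?_⟩
  · have hmixed : ∑ i, deriv (P q (e i)) (z q) * fderiv ℝ z q (e i) = 0 := by
      have h1 : D * ∑ i, deriv (P q (e i)) (z q) * fderiv ℝ z q (e i) = 0 := by
        rw [← neg_eq_zero, ← hconf', Finset.mul_sum, ← Finset.sum_neg_distrib]
        exact Finset.sum_congr rfl fun i _ => by
          linear_combination -deriv (P q (e i)) (z q) * hfirst i
      exact (mul_eq_zero.mp h1).resolve_left hreg
    have hsum := Finset.sum_eq_zero fun i (_ : i ∈ Finset.univ) => (key (e i)).2
    simp only [Finset.sum_add_distrib, ← Finset.mul_sum, hgrad, hmixed, hharm, mul_zero,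
      zero_add, add_zero] at hsum
    exact (mul_eq_zero.mp hsum).resolve_left hreg
  · have h1 : D * ∑ i, (x i : ℂ) * fderiv ℝ z q (e i) = 0 := by
      have h2 : -∑ i, (x i : ℂ) * P q (e i) (z q) = 0 := by rw [hrad, hsol q hq]; simp
      rw [← h2, Finset.mul_sum, ← Finset.sum_neg_distrib]
      exact Finset.sum_congr rfl fun i _ => by linear_combination (x i : ℂ) * hfirst i
    exact (mul_eq_zero.mp h1).resolve_left hreg


/-- Example 4.7 of the paper. On a domain `U ⊆ ℂ³ \ {0} ≅ ℝ⁶ \ {0}`,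
any C² solution `z` of
`(q¹ − μ₁(z)q̄² − μ₂(z)q̄³)² = z²·((q² + μ₁(z)q̄¹ − μ₃(z)q̄³)² + (q³ + μ₂(z)q̄¹ + μ₃(z)q̄²)²)`
(with `μ₁, μ₂, μ₃` holomorphic and nonvanishing `ζ`-derivative) is a harmonic
morphism which is invariant under radial projection:
`Σ_j x^j·∂z/∂x^j = 0`, so it restricts to a harmonic morphism on domains of `S⁵`. -/
theorem example_S5_harmonic_morphism
    (μ₁ μ₂ μ₃ : ℂ → ℂ)
    (hμ₁ : Differentiable ℂ μ₁) (hμ₂ : Differentiable ℂ μ₂)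
    (hμ₃ : Differentiable ℂ μ₃)
    (U : Set (Fin 3 → ℂ)) (hU : IsOpen U) (hU0 : ∀ q ∈ U, q ≠ 0)
    (z : (Fin 3 → ℂ) → ℂ) (hz : ContDiffOn ℝ 2 z U)
    (hsol : ∀ q ∈ U,
      (q 0 - μ₁ (z q) * (starRingEnd ℂ) (q 1) - μ₂ (z q) * (starRingEnd ℂ) (q 2)) ^ 2
        = (z q) ^ 2 *
          ((q 1 + μ₁ (z q) * (starRingEnd ℂ) (q 0) - μ₃ (z q) * (starRingEnd ℂ) (q 2)) ^ 2
          + (q 2 + μ₂ (z q) * (starRingEnd ℂ) (q 0) + μ₃ (z q) * (starRingEnd ℂ) (q 1)) ^ 2))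
    (hreg : ∀ q ∈ U,
      deriv (fun ζ =>
        (q 0 - μ₁ ζ * (starRingEnd ℂ) (q 1) - μ₂ ζ * (starRingEnd ℂ) (q 2)) ^ 2
          - ζ ^ 2 *
            ((q 1 + μ₁ ζ * (starRingEnd ℂ) (q 0) - μ₃ ζ * (starRingEnd ℂ) (q 2)) ^ 2
            + (q 2 + μ₂ ζ * (starRingEnd ℂ) (q 0) + μ₃ ζ * (starRingEnd ℂ) (q 1)) ^ 2))
        (z q) ≠ 0) :
    ∀ q ∈ U,
      (∑ j, ((fderiv ℝ z q (Pi.single j 1)) ^ 2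
            + (fderiv ℝ z q (Pi.single j Complex.I)) ^ 2) = 0) ∧
      (∑ j, (fderiv ℝ (fun p => fderiv ℝ z p (Pi.single j 1)) q (Pi.single j 1)
            + fderiv ℝ (fun p => fderiv ℝ z p (Pi.single j Complex.I)) q
                (Pi.single j Complex.I)) = 0) ∧
      (∑ j, (((q j).re : ℂ) * fderiv ℝ z q (Pi.single j 1)
            + ((q j).im : ℂ) * fderiv ℝ z q (Pi.single j Complex.I)) = 0) := by
  intro q hq
  let A : (Fin 3 → ℂ) → ℂ → ℂ := fun p ζ =>
    p 0 - μ₁ ζ * (starRingEnd ℂ) (p 1) - μ₂ ζ * (starRingEnd ℂ) (p 2)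
  let B : (Fin 3 → ℂ) → ℂ → ℂ := fun p ζ =>
    p 1 + μ₁ ζ * (starRingEnd ℂ) (p 0) - μ₃ ζ * (starRingEnd ℂ) (p 2)
  let C : (Fin 3 → ℂ) → ℂ → ℂ := fun p ζ =>
    p 2 + μ₂ ζ * (starRingEnd ℂ) (p 0) + μ₃ ζ * (starRingEnd ℂ) (p 1)
  have hA : ∀ p, Differentiable ℂ (A p) := fun p => by fun_prop
  have hB : ∀ p, Differentiable ℂ (B p) := fun p => by fun_prop
  have hC : ∀ p, Differentiable ℂ (C p) := fun p => by fun_prop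
  have h := harmonicMorphism_of_implicit_quadratic (ι := Fin 3 × Fin 2) hU hz
    (F := fun p ζ => A p ζ ^ 2 - ζ ^ 2 * (B p ζ ^ 2 + C p ζ ^ 2))
    (P := fun p v ζ => 2 * (A p ζ * A v ζ - ζ ^ 2 * (B p ζ * B v ζ + C p ζ * C v ζ)))
    (fun p => by fun_prop) (fun p v => by fun_prop)
    (fun p v t ζ => by
      simp only [A, B, C, Pi.add_apply, Pi.smul_apply, Complex.real_smul, map_add, map_mul,
        Complex.conj_ofReal]
      ring)
    (fun p hp => sub_eq_zero.mpr (hsol p hp)) hq (hreg q hq)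
    (fun i => Pi.single i.1 (![1, Complex.I] i.2)) (fun i => ![(q i.1).re, (q i.1).im] i.2)
    (fun ζ => by
      simp [A, B, C, Fintype.sum_prod_type, Fin.sum_univ_three]
      ring_nf
      simp only [Complex.I_sq]
      ring)
    (fun ζ => by
      simp [A, B, C, Fintype.sum_prod_type, Fin.sum_univ_three]
      ring_nf
      simp only [Complex.I_sq]
      ring)
    (fun ζ => by
      have hre : ∀ w : ℂ, (w.re : ℂ) = (w + (starRingEnd ℂ) w) / 2 := fun w =>
        Complex.re_eq_add_conj w
      have him : ∀ w : ℂ, (w.im : ℂ) = -Complex.I * (w - (starRingEnd ℂ) w) / 2 := fun w => by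
        rw [Complex.sub_conj]
        push_cast
        linear_combination (w.im : ℂ) * Complex.I_sq
      simp [A, B, C, Fintype.sum_prod_type, Fin.sum_univ_three, hre, him]
      ring_nf
      simp only [Complex.I_sq]
      ring)
  simpa [Fintype.sum_prod_type, Fin.sum_univ_two] using h
end
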